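/- An $\{R,S\}$-arrival instance in simple form consists of a finite directed graph $(V,E)$, a start vertex $s\in V$, a target $t\in V$ and a dead end $d\in V$, $d\neq t$, whose only out-edges are the self-loops $(t,t)$ and $(d,d)$, and a partition of $V\setminus\{t,d\}$ into random vertices $V_R$ and switching vertices $V_S$, such that every $v\in V\setminus\{t,d\}$ has exactly two out-neighbours, both different from $v$, and every $v\in V_S$ carries an ordering $\mathrm{Ord}(v)=(\mathrm{Ord}(v)_0,\mathrm{Ord}(v)_1)$ of its two out-neighbours. A state is a pair $(v,q)$ with $v\in V$ and $q\colon V_S\to\{0,1\}$. From $(v,q)$ the play moves as follows: if $v\in V_S$, to the vertex $\mathrm{Ord}(v)_{q(v)}$, and $q(v)$ is replaced by $1-q(v)$; if $v\in V_R$, to each of the two out-neighbours of $v$ with probability $1/2$, independently of the past, with $q$ unchanged; if $v\in\{t,d\}$, the state stays the same. The play starts at $(s,q_0)$ with $q_0\equiv 0$. An edge $(v,w)\in E$ is hopeful if $t$ is reachable from $w$ in $(V,E)$, and its desperation is then the length of a shortest directed path from $w$ to $t$. Let $G$ be an $\{R,S\}$-arrival instance in simple form and let $e\neq(t,t)$ be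 a hopeful edge of $G$ of desperation $k$. Let $T_e$ be the random variable counting the number of traversals of $e$ in the play started at $(s,q_0)$. Then $$\mathbb{E}[T_e]\le 2^{k+1}-1 .$$ -/

import Mathlib

open MeasureTheory ProbabilityTheory
open scoped ENNReal

/-- A generalised arrival instance on a finite vertex type `V`; the edges are the pairs `(v, w)`
with `w ∈ succ v`. -/
structure ArrivalInstance (V : Type*) [Fintype V] [DecidableEq V] where
  /-- out-neighbours -/
  succ : V → Finset V
  succ_nonempty : ∀ v, (succ v).Nonempty
  start : V
  target : V
  /-- random vertices -/
  VR : Finset V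
  /-- switching vertices -/
  VS : Finset V
  /-- max-player vertices -/
  V1 : Finset V
  /-- min-player vertices -/
  V2 : Finset V
  target_loop : succ target = {target}
  target_not_R : target ∉ VR
  target_not_S : target ∉ VS
  target_not_1 : target ∉ V1
  target_not_2 : target ∉ V2
  disj_RS : Disjoint VR VS
  disj_R1 : Disjoint VR V1
  disj_R2 : Disjoint VR V2
  disj_S1 : Disjoint VS V1
  disj_S2 : Disjoint VS V2
  disj_12 : Disjoint V1 V2
  /-- The four classes cover all vertices but the target. A vertex whose only out-edge is a
  self-loop may also be left unclassified, because in simple form the dead end belongs to no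
  class. -/
  cover : ∀ v, v ≠ target → v ∉ VR → v ∉ VS → v ∉ V1 → v ∉ V2 → succ v = {v}
  /-- transition probabilities at the random vertices -/
  P : VR → PMF V
  P_support : ∀ (v : VR) (w : V), w ∈ (P v).support ↔ w ∈ succ v
  /-- switching orders at the switching vertices -/
  ord : VS → List V
  ord_mem : ∀ (v : VS) (w : V), w ∈ ord v ↔ w ∈ succ v

namespace ArrivalInstance

variable {V : Type*} [Fintype V] [DecidableEq V]

theorem ord_length_pos (G : ArrivalInstance V) (u : G.VS) : 0 < (G.ord u).length := by
  obtain ⟨w, hw⟩ := G.succ_nonempty u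
  exact List.length_pos_of_mem ((G.ord_mem u w).2 hw)

/-- switching positions `q`, with `q u < |Ord(u)|` -/
abbrev Pos (G : ArrivalInstance V) : Type _ := (u : G.VS) → Fin (G.ord u).length

/-- the initial switching position: `0` everywhere -/
def q0 (G : ArrivalInstance V) : G.Pos := fun u => ⟨0, G.ord_length_pos u⟩

/-- states `(v, q)` -/
def State (G : ArrivalInstance V) : Type _ := V × G.Pos

instance (G : ArrivalInstance V) : Finite G.State := inferInstanceAs (Finite (V × G.Pos))

instance (G : ArrivalInstance V) : MeasurableSpace G.State := ⊤

instance (G : ArrivalInstance V) : DiscreteMeasurableSpace G.State := ⟨fun _ => trivial⟩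

/-- the initial state `(s, q₀)` -/
def initState (G : ArrivalInstance V) : G.State := (G.start, G.q0)

/-- the position after using the switching vertex `u`: `q u` is incremented cyclically -/
def switchUpd (G : ArrivalInstance V) (u : G.VS) (q : G.Pos) : G.Pos :=
  Function.update q u ⟨((q u : ℕ) + 1) % (G.ord u).length, Nat.mod_lt _ (G.ord_length_pos u)⟩

/-- Law of the next state, for instances without player vertices. The last branch then concerns
only vertices whose only out-edge is a self-loop (the target, possibly a dead end). -/
noncomputable def step (G : ArrivalInstance V) (x : G.State) : PMF G.State :=
  if h : x.1 ∈ G.VS then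
    PMF.pure ((G.ord ⟨x.1, h⟩).get (x.2 ⟨x.1, h⟩), G.switchUpd ⟨x.1, h⟩ x.2)
  else if h : x.1 ∈ G.VR then (G.P ⟨x.1, h⟩).map fun w => (w, x.2)
  else PMF.pure x

/-- the transition kernel of the Markov chain on states -/
noncomputable def stepKernel (G : ArrivalInstance V) : Kernel G.State G.State where
  toFun x := (G.step x).toMeasure
  measurable' := measurable_from_top

instance (G : ArrivalInstance V) : IsMarkovKernel G.stepKernel :=
  ⟨fun x => PMF.toMeasure.isProbabilityMeasure (G.step x)⟩

/-- the law of the state at time `n + 1` given the states at times `0, …, n` -/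
noncomputable def historyKernel (G : ArrivalInstance V) (n : ℕ) :
    Kernel ((_ : Finset.Iic n) → G.State) G.State :=
  G.stepKernel.comap (fun h => h ⟨n, Finset.mem_Iic.2 le_rfl⟩) (measurable_pi_apply _)

instance (G : ArrivalInstance V) (n : ℕ) : IsMarkovKernel (G.historyKernel n) :=
  inferInstanceAs (IsMarkovKernel (Kernel.comap _ _ _))

/-- the probability measure on infinite plays started at `(s, q₀)` -/
noncomputable def playMeasure (G : ArrivalInstance V) : Measure (ℕ → G.State) :=
  Kernel.traj (X := fun _ => G.State) G.historyKernel 0 (fun _ => G.initState)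

/-- `T_e` for `e = (v, w)`: the number of traversals of `e` in a play -/
noncomputable def traversals (G : ArrivalInstance V) (v w : V) (π : ℕ → G.State) : ℝ≥0∞ :=
  ∑' n : ℕ, if (π n).1 = v ∧ (π (n + 1)).1 = w then 1 else 0

/-- an {R,S}-instance: no player vertices -/
def IsRS (G : ArrivalInstance V) : Prop := G.V1 = ∅ ∧ G.V2 = ∅

/-- Simple form, with dead end `d`. It is not prescribed whether `d` lies in a class: its only
out-edge is the self-loop in any case. -/
structure SimpleForm (G : ArrivalInstance V) (d : V) : Prop where
  d_ne_target : d ≠ G.target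
  d_loop : G.succ d = {d}
  degree_two : ∀ v, v ≠ G.target → v ≠ d → (G.succ v).card = 2 ∧ v ∉ G.succ v
  rand_uniform : ∀ v : G.VR, (v : V) ≠ d → ∀ w ∈ G.succ v, G.P v w = 1 / 2
  switch_ord : ∀ v : G.VS, (v : V) ≠ d → (G.ord v).length = 2 ∧ (G.ord v).Nodup

/-- `v` is hopeful: some (memoryless) strategy `σ` of player 1, who controls all vertices outside
`V2`, makes every play from `v` on the graph that is consistent with `σ` visit the target. -/
def Hopeful (G : ArrivalInstance V) (v : V) : Prop :=
  ∃ σ : V → V, (∀ u, u ∉ G.V2 → σ u ∈ G.succ u) ∧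
    ∀ π : ℕ → V, π 0 = v → (∀ n, π (n + 1) ∈ G.succ (π n)) →
      (∀ n, π n ∉ G.V2 → π (n + 1) = σ (π n)) → ∃ n, π n = G.target

/-- `(v, w)` is a hopeful edge -/
def HopefulEdge (G : ArrivalInstance V) (v w : V) : Prop := w ∈ G.succ v ∧ G.Hopeful w

/-- there is a directed walk of length `n` from `a` to `b` -/
def ReachesIn (G : ArrivalInstance V) : ℕ → V → V → Prop
  | 0, a, b => a = b
  | n + 1, a, b => ∃ c ∈ G.succ a, G.ReachesIn n c b

/-- the hopeful edge `(v, w)` has desperation `k`: the shortest directed path from `w` to the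
target has length `k` -/
def HasDesperation (G : ArrivalInstance V) (v w : V) (k : ℕ) : Prop :=
  G.HopefulEdge v w ∧ IsLeast {n | G.ReachesIn n w G.target} k

end ArrivalInstance

namespace ArrivalInstance

variable {V : Type*} [Fintype V] [DecidableEq V]

instance (G : ArrivalInstance V) : IsProbabilityMeasure G.playMeasure :=
  inferInstanceAs (IsProbabilityMeasure (Kernel.traj _ _ _))

/-- The Markov property of the play: the state at time `n + 1` is drawn by `step` from the state
at time `n`. -/
theorem lintegral_playMeasure_step (G : ArrivalInstance V) (n : ℕ)
    (f : G.State → G.State → ℝ≥0∞) :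
    ∫⁻ π, f (π n) (π (n + 1)) ∂G.playMeasure =
      ∫⁻ π, ∫⁻ y, f (π n) y ∂(G.step (π n)).toMeasure ∂G.playMeasure := by
  have hf : Measurable fun p : ((_ : Finset.Iic n) → G.State) × G.State =>
      f (p.1 ⟨n, Finset.mem_Iic.2 le_rfl⟩) p.2 :=
    Measurable.comp (g := fun p : G.State × G.State => f p.1 p.2) .of_discrete
      (f := fun p : ((_ : Finset.Iic n) → G.State) × G.State =>
        (p.1 ⟨n, Finset.mem_Iic.2 le_rfl⟩, p.2)) (by fun_prop)
  have hg : Measurable fun h : (_ : Finset.Iic n) → G.State =>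
      ∫⁻ y, f (h ⟨n, Finset.mem_Iic.2 le_rfl⟩) y
        ∂(G.step (h ⟨n, Finset.mem_Iic.2 le_rfl⟩)).toMeasure :=
    (Measurable.of_discrete (f := fun x : G.State =>
      ∫⁻ y, f x y ∂(G.step x).toMeasure)).comp (measurable_pi_apply _)
  have hcp := Kernel.partialTraj_compProd_eq_map_traj (X := fun _ => G.State)
    (κ := G.historyKernel) (Nat.zero_le n) (x₀ := fun _ => G.initState)
  have hmap := Kernel.traj_map_frestrictLe_apply (X := fun _ => G.State)
    (κ := G.historyKernel) 0 n (fun _ => G.initState)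
  calc ∫⁻ π, f (π n) (π (n + 1)) ∂G.playMeasure
      = ∫⁻ p, f (p.1 ⟨n, Finset.mem_Iic.2 le_rfl⟩) p.2 ∂(G.playMeasure.map
          (fun x => (Preorder.frestrictLe (π := fun _ => G.State) n x, x (n + 1)))) := by
        rw [lintegral_map hf (by fun_prop)]
        rfl
    _ = ∫⁻ h, ∫⁻ y, f (h ⟨n, Finset.mem_Iic.2 le_rfl⟩) y
          ∂(G.step (h ⟨n, Finset.mem_Iic.2 le_rfl⟩)).toMeasure
          ∂(Kernel.partialTraj (X := fun _ => G.State) G.historyKernel 0 n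
            (fun _ => G.initState)) := by
        rw [playMeasure, ← hcp, Measure.lintegral_compProd hf]
        rfl
    _ = _ := by
        rw [← hmap, lintegral_map hg (by fun_prop)]
        rfl

theorem measurable_pair_of_play (G : ArrivalInstance V) (n : ℕ) (f : G.State → G.State → ℝ≥0∞) :
    Measurable fun π : ℕ → G.State => f (π n) (π (n + 1)) :=
  Measurable.comp (g := fun p : G.State × G.State => f p.1 p.2) .of_discrete
    (f := fun π : ℕ → G.State => (π n, π (n + 1))) (by fun_prop)

theorem ae_step_ne_zero (G : ArrivalInstance V) :
    ∀ᵐ π ∂G.playMeasure, ∀ n, G.step (π n) (π (n + 1)) ≠ 0 := by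
  classical
  rw [ae_all_iff]
  intro n
  have h := G.lintegral_playMeasure_step n fun x y => if G.step x y = 0 then 1 else 0
  have h0 : ∀ x : G.State,
      ∫⁻ y, (if G.step x y = 0 then 1 else 0 : ℝ≥0∞) ∂(G.step x).toMeasure = 0 := by
    intro x
    rw [lintegral_eq_zero_iff Measurable.of_discrete]
    rw [Filter.EventuallyEq, ae_iff,
      PMF.toMeasure_apply_eq_zero_iff _ MeasurableSet.of_discrete]
    rw [Set.disjoint_left]
    intro y hy
    simpa using hy
  simp only [h0, lintegral_zero] at h
  have hm : Measurable fun π : ℕ → G.State =>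
      (if G.step (π n) (π (n + 1)) = 0 then 1 else 0 : ℝ≥0∞) :=
    G.measurable_pair_of_play n fun x y => if G.step x y = 0 then 1 else 0
  rw [lintegral_eq_zero_iff hm] at h
  filter_upwards [h] with π hπ
  simpa using hπ

/-- the number of visits to the vertex `w` in a play -/
noncomputable def visits (G : ArrivalInstance V) (w : V) (π : ℕ → G.State) : ℝ≥0∞ :=
  ∑' n : ℕ, if (π n).1 = w then 1 else 0

theorem traversals_le_visits (G : ArrivalInstance V) (v w : V) (π : ℕ → G.State) :
    G.traversals v w π ≤ G.visits w π := by
  refine le_trans (ENNReal.tsum_le_tsum fun n => ?_)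
    (ENNReal.tsum_comp_le_tsum_of_injective (add_left_injective 1)
      (fun n : ℕ => if (π n).1 = w then (1 : ℝ≥0∞) else 0))
  by_cases h : (π (n + 1)).1 = w
  · simp only [h, if_true]
    split_ifs <;> simp
  · simp [h]

theorem step_of_fst_eq_target (G : ArrivalInstance V) {x : G.State} (hx : x.1 = G.target) :
    G.step x = PMF.pure x := by
  rw [step, dif_neg (by rw [hx]; exact G.target_not_S),
    dif_neg (by rw [hx]; exact G.target_not_R)]

/-- Every edge into the target, other than the self-loop, is traversed at most once. -/
theorem traversals_target_le_one (G : ArrivalInstance V) {v : V} (hv : v ≠ G.target)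
    {π : ℕ → G.State} (hπ : ∀ n, G.step (π n) (π (n + 1)) ≠ 0) :
    G.traversals v G.target π ≤ 1 := by
  have hstay : ∀ n, (π n).1 = G.target → ∀ m, n ≤ m → (π m).1 = G.target := by
    intro n hn m hm
    induction m, hm using Nat.le_induction with
    | base => exact hn
    | succ m _ ih =>
      have h := hπ m
      rw [G.step_of_fst_eq_target ih, ← PMF.mem_support_iff, PMF.support_pure,
        Set.mem_singleton_iff] at h
      rw [h, ih]
  have huniq : ∀ n m, (π (n + 1)).1 = G.target → (π m).1 = v → m ≤ n := by
    intro n m hn hm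
    by_contra hlt
    exact hv (hm ▸ hstay _ hn m (by lia))
  by_cases h : ∃ n, (π n).1 = v ∧ (π (n + 1)).1 = G.target
  · obtain ⟨n, hn⟩ := h
    rw [traversals, tsum_eq_single n]
    · rw [if_pos hn]
    · intro m hmn
      refine if_neg fun hm => hmn ?_
      exact le_antisymm (huniq n m hn.2 hm.1) (huniq m n hm.2 hn.1)
  · push Not at h
    have : G.traversals v G.target π = 0 :=
      ENNReal.tsum_eq_zero.2 fun n => if_neg fun hn => h n hn.1 hn.2
    simp [this]

theorem lintegral_traversals_target_le_one (G : ArrivalInstance V) {v : V}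
    (hv : v ≠ G.target) : ∫⁻ π, G.traversals v G.target π ∂G.playMeasure ≤ 1 := by
  calc ∫⁻ π, G.traversals v G.target π ∂G.playMeasure
      ≤ ∫⁻ _, 1 ∂G.playMeasure := by
        refine lintegral_mono_ae ?_
        filter_upwards [G.ae_step_ne_zero] with π hπ
        exact G.traversals_target_le_one hv hπ
    _ = 1 := by simp

/-- From a random vertex of a simple form, each out-edge is taken with probability `1 / 2`. -/
theorem lintegral_visits_of_random (G : ArrivalInstance V) {d : V} (hSF : G.SimpleForm d)
    {w u : V} (hw : w ∈ G.VR) (hwd : w ≠ d) (hu : u ∈ G.succ w) :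
    ∫⁻ π, G.visits w π ∂G.playMeasure = 2 * ∫⁻ π, G.traversals w u π ∂G.playMeasure := by
  have hwS : w ∉ G.VS := Finset.disjoint_left.1 G.disj_RS hw
  have hm : ∀ n, Measurable fun π : ℕ → G.State => if (π n).1 = w then (1 : ℝ≥0∞) else 0 :=
    fun n => G.measurable_pair_of_play n fun x _ => if x.1 = w then 1 else 0
  have hm' : ∀ n, Measurable fun π : ℕ → G.State =>
      if (π n).1 = w ∧ (π (n + 1)).1 = u then (1 : ℝ≥0∞) else 0 :=
    fun n => G.measurable_pair_of_play n fun x y => if x.1 = w ∧ y.1 = u then 1 else 0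
  have hstep : ∀ x : G.State,
      ∫⁻ y, (if x.1 = w ∧ y.1 = u then (1 : ℝ≥0∞) else 0) ∂(G.step x).toMeasure =
        2⁻¹ * if x.1 = w then (1 : ℝ≥0∞) else 0 := by
    intro x
    by_cases hx : x.1 = w
    · subst hx
      have hset : (fun y : G.State => if x.1 = x.1 ∧ y.1 = u then (1 : ℝ≥0∞) else 0) =
          Set.indicator {y : G.State | y.1 = u} 1 := by
        ext y
        simp [Set.indicator_apply]
      have hpre : (fun a : V => ((a, x.2) : G.State)) ⁻¹' {y : G.State | y.1 = u} = {u} := by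
        ext a
        rfl
      rw [hset, lintegral_indicator_one MeasurableSet.of_discrete, step, dif_neg hwS, dif_pos hw,
        PMF.toMeasure_apply_eq_toOuterMeasure]
      refine (PMF.toOuterMeasure_map_apply (β := G.State) _ _ _).trans ?_
      refine (congrArg (G.P ⟨x.1, hw⟩).toOuterMeasure hpre).trans ?_
      rw [PMF.toOuterMeasure_apply_singleton, hSF.rand_uniform _ hwd _ hu]
      simp
    · simp [hx]
  simp only [visits, traversals]
  rw [lintegral_tsum fun n => (hm n).aemeasurable, lintegral_tsum fun n => (hm' n).aemeasurable,
    ← ENNReal.tsum_mul_left]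
  refine tsum_congr fun n => ?_
  rw [G.lintegral_playMeasure_step n fun x y => if x.1 = w ∧ y.1 = u then 1 else 0]
  simp only [hstep]
  rw [lintegral_const_mul _ (hm n), ← mul_assoc,
    ENNReal.mul_inv_cancel two_ne_zero ENNReal.ofNat_ne_top, one_mul]

theorem eq_of_step_ne_zero_of_mem_VS (G : ArrivalInstance V) {x y : G.State} (hx : x.1 ∈ G.VS)
    (h : G.step x y ≠ 0) :
    y = ((G.ord ⟨x.1, hx⟩).get (x.2 ⟨x.1, hx⟩), G.switchUpd ⟨x.1, hx⟩ x.2) := by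
  rw [step, dif_pos hx] at h
  exact (PMF.mem_support_pure_iff _ _).1 h

/-- The switching position of `w` changes only when `w` is left. -/
theorem snd_apply_eq_of_step_ne_zero (G : ArrivalInstance V) {x y : G.State}
    (h : G.step x y ≠ 0) {w : G.VS} (hx : x.1 ≠ w) : y.2 w = x.2 w := by
  rw [step] at h
  split_ifs at h with hS hR
  · rw [(PMF.mem_support_pure_iff _ _).1 h]
    refine Function.update_of_ne (fun hw => hx ?_) _ _
    rw [hw]
  · obtain ⟨a, -, rfl⟩ := (PMF.mem_support_map_iff _ _ _).1 h
    rfl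
  · rw [(PMF.mem_support_pure_iff _ _).1 h]

/-- A switching vertex with two out-neighbours uses each out-edge at every other visit. -/
theorem visits_le_of_switching (G : ArrivalInstance V) {w : G.VS} (hlen : (G.ord w).length = 2)
    {u : V} (hu : u ∈ G.succ w) {π : ℕ → G.State}
    (hπ : ∀ n, G.step (π n) (π (n + 1)) ≠ 0) :
    G.visits w π ≤ 2 * G.traversals w u π + 1 := by
  obtain ⟨i, hi⟩ := List.get_of_mem ((G.ord_mem w u).2 hu)
  have key : ∀ N : ℕ, (∑ n ∈ Finset.range N, if (π n).1 = w then 1 else 0) +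
      (if (π N).2 w = i then 0 else 1) ≤
      2 * (∑ n ∈ Finset.range N, if (π n).1 = w ∧ (π (n + 1)).1 = u then 1 else 0) + 1 := by
    intro N
    induction N with
    | zero =>
      simp only [Finset.range_zero, Finset.sum_empty]
      split_ifs <;> simp
    | succ N ih =>
      rw [Finset.sum_range_succ, Finset.sum_range_succ]
      by_cases hN : (π N).1 = w
      · have hS : (π N).1 ∈ G.VS := hN ▸ w.2
        have hw : (⟨(π N).1, hS⟩ : G.VS) = w := Subtype.ext hN
        have hy := G.eq_of_step_ne_zero_of_mem_VS hS (hπ N)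
        rw [hw] at hy
        have hq : (((π (N + 1)).2 w : Fin _) : ℕ) = ((π N).2 w + 1) % (G.ord w).length := by
          rw [hy]
          simp [switchUpd]
        by_cases hqi : (π N).2 w = i
        · have hnext : (π (N + 1)).1 = u := by rw [hy, ← hi, ← hqi]
          simp only [hN, hnext, hqi, and_self, if_true] at ih ⊢
          split_ifs <;> lia
        · have hqi' : (π (N + 1)).2 w = i := by
            have h1 := ((π N).2 w).2
            have h2 := i.2
            have h3 : ((π N).2 w : ℕ) ≠ i := fun h => hqi (Fin.ext h)
            apply Fin.ext
            rw [hq]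
            lia
          simp only [hN, hqi, hqi', if_true, if_false] at ih ⊢
          split_ifs <;> lia
      · rw [G.snd_apply_eq_of_step_ne_zero (hπ N) hN]
        simpa [hN] using ih
  refine ENNReal.tsum_le_of_sum_range_le fun N => ?_
  have hN := (Nat.le_add_right _ _).trans (key N)
  have hN' : (∑ n ∈ Finset.range N, if (π n).1 = w then (1 : ℝ≥0∞) else 0) ≤
      2 * (∑ n ∈ Finset.range N,
        if (π n).1 = w ∧ (π (n + 1)).1 = u then (1 : ℝ≥0∞) else 0) + 1 := by
    exact_mod_cast hN
  refine hN'.trans ?_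
  gcongr
  exact ENNReal.sum_le_tsum _

theorem not_reachesIn_of_succ_eq_singleton (G : ArrivalInstance V) {a b : V}
    (ha : G.succ a = {a}) (hab : a ≠ b) (n : ℕ) : ¬ G.ReachesIn n a b := by
  induction n with
  | zero => exact hab
  | succ n ih =>
    rintro ⟨c, hc, h⟩
    rw [ha, Finset.mem_singleton] at hc
    exact ih (hc ▸ h)

theorem lintegral_visits_le (G : ArrivalInstance V) {d : V} (hRS : G.IsRS)
    (hSF : G.SimpleForm d) {w u : V} (hwt : w ≠ G.target) (hwd : w ≠ d) (hu : u ∈ G.succ w) :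
    ∫⁻ π, G.visits w π ∂G.playMeasure ≤
      2 * (∫⁻ π, G.traversals w u π ∂G.playMeasure) + 1 := by
  by_cases hR : w ∈ G.VR
  · rw [G.lintegral_visits_of_random hSF hR hwd hu]
    exact le_self_add
  · have hS : w ∈ G.VS := by
      by_contra hS
      obtain ⟨h1, h2⟩ := hRS
      have hloop := G.cover w hwt hR hS (by simp [h1]) (by simp [h2])
      exact (hSF.degree_two w hwt hwd).2 (by simp [hloop])
    calc ∫⁻ π, G.visits w π ∂G.playMeasure
        ≤ ∫⁻ π, (2 * G.traversals w u π + 1) ∂G.playMeasure := by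
          refine lintegral_mono_ae ?_
          filter_upwards [G.ae_step_ne_zero] with π hπ
          exact G.visits_le_of_switching (w := ⟨w, hS⟩) (hSF.switch_ord ⟨w, hS⟩ hwd).1 hu hπ
      _ = 2 * (∫⁻ π, G.traversals w u π ∂G.playMeasure) + 1 := by
          rw [lintegral_add_right _ measurable_const,
            lintegral_const_mul' _ _ ENNReal.ofNat_ne_top]
          simp

theorem lintegral_traversals_le_of_reachesIn (G : ArrivalInstance V) {d : V} (hRS : G.IsRS)
    (hSF : G.SimpleForm d) (k : ℕ) {v w : V} (hv : v ≠ G.target)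
    (hk : G.ReachesIn k w G.target) :
    ∫⁻ π, G.traversals v w π ∂G.playMeasure ≤ 2 ^ (k + 1) - 1 := by
  have hpow : ∀ n : ℕ, (2 ^ n - 1 : ℝ≥0∞) + 1 = 2 ^ n := fun n =>
    tsub_add_cancel_of_le (one_le_pow₀ one_le_two)
  have hsucc : ∀ n : ℕ, (2 ^ (n + 1) - 1 : ℝ≥0∞) = 2 * (2 ^ n - 1) + 1 := by
    intro n
    refine ENNReal.sub_eq_of_eq_add ENNReal.one_ne_top ?_
    rw [pow_succ', ← hpow n, ENNReal.add_sub_cancel_right ENNReal.one_ne_top]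
    ring
  induction k generalizing v w with
  | zero =>
    obtain rfl : w = G.target := hk
    rw [hsucc]
    exact (G.lintegral_traversals_target_le_one hv).trans le_add_self
  | succ k ih =>
    by_cases hwt : w = G.target
    · subst hwt
      rw [hsucc]
      exact (G.lintegral_traversals_target_le_one hv).trans le_add_self
    · have hwd : w ≠ d := by
        rintro rfl
        exact G.not_reachesIn_of_succ_eq_singleton hSF.d_loop hwt _ hk
      obtain ⟨u, hu, hku⟩ := hk
      calc ∫⁻ π, G.traversals v w π ∂G.playMeasure
          ≤ ∫⁻ π, G.visits w π ∂G.playMeasure :=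
            lintegral_mono fun π => G.traversals_le_visits v w π
        _ ≤ 2 * (∫⁻ π, G.traversals w u π ∂G.playMeasure) + 1 :=
            G.lintegral_visits_le hRS hSF hwt hwd hu
        _ ≤ 2 * (2 ^ (k + 1) - 1) + 1 := by
            gcongr
            exact ih hwt hku
        _ = 2 ^ (k + 1 + 1) - 1 := (hsucc _).symm

end ArrivalInstance

/-- In an {R,S}-instance in simple form, the expected number of traversals of a hopeful edge
`(v, w)` of desperation `k`, other than the self-loop at the target, is at most
`2 ^ (k + 1) - 1`. -/
theorem stmt_5 {V : Type*} [Fintype V] [DecidableEq V] (G : ArrivalInstance V) (d : V)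
    (hRS : G.IsRS) (hSF : G.SimpleForm d) (v w : V) (hv : v ≠ G.target) (k : ℕ)
    (hk : G.HasDesperation v w k) :
    ∫⁻ π, G.traversals v w π ∂G.playMeasure ≤ 2 ^ (k + 1) - 1 :=
  G.lintegral_traversals_le_of_reachesIn hRS hSF k hv hk.2.1
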